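/- arXiv:2308.03414 — 2 statements merged into one kernel-verified Lean document; each statement's English description precedes it below -/
import Mathlib

section
/- Let t ≥ 3 and let G be a (P5,dart)-free finite simple graph containing an induced copy C of the complement of the (2t+1)-cycle, with vertices v1,...,v_{2t+1} such that v_i and v_j are adjacent if and only if their circular distance modulo 2t+1 is greater than 1. Then every vertex of G not on C that has at least one neighbor on C has at least t+1 neighbors on C; that is, S_m = ∅ for all 1 ≤ m ≤ t. -/
open SimpleGraph

/-- `G` contains an induced subgraph isomorphic to `H`. -/
def ContainsInduced {V : Type*} {W : Type*} (G : SimpleGraph V) (H : SimpleGraph W) : Prop :=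
  ∃ f : W ↪ V, ∀ a b, H.Adj a b ↔ G.Adj (f a) (f b)

/-- The path on 5 vertices. -/
def P5 : SimpleGraph (Fin 5) := SimpleGraph.pathGraph 5

/-- The dart: vertices `0,1,2,3,4` and edges `01, 12, 23, 30, 02, 24`. -/
def dart : SimpleGraph (Fin 5) :=
  SimpleGraph.fromRel (fun a b =>
    (a, b) = (0, 1) ∨ (a, b) = (1, 2) ∨ (a, b) = (2, 3) ∨
    (a, b) = (3, 0) ∨ (a, b) = (0, 2) ∨ (a, b) = (2, 4))

/-- `G` is `k`-vertex-critical: `χ(G) = k` and `χ(G - v) < k` for every vertex `v`. -/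
def IsVertexCritical {V : Type*} (G : SimpleGraph V) (k : ℕ) : Prop :=
  G.chromaticNumber = k ∧
  ∀ v : V, (G.induce {u | u ≠ v}).chromaticNumber < k

/-- An induced `P5` from its adjacencies and non-adjacencies. -/
lemma containsInduced_P5 {V : Type*} (G : SimpleGraph V) {a b c d e : V}
    (hab : G.Adj a b) (hbc : G.Adj b c) (hcd : G.Adj c d) (hde : G.Adj d e)
    (hac : ¬ G.Adj a c) (had : ¬ G.Adj a d) (hae : ¬ G.Adj a e)
    (hbd : ¬ G.Adj b d) (hbe : ¬ G.Adj b e) (hce : ¬ G.Adj c e) :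
    ContainsInduced G P5 := by
  have key : ∀ x y, P5.Adj x y ↔ G.Adj (![a, b, c, d, e] x) (![a, b, c, d, e] y) := by
    intro x y
    fin_cases x <;> fin_cases y <;>
      simp [P5, SimpleGraph.pathGraph_adj, *, G.adj_comm b a, G.adj_comm c a, G.adj_comm d a,
        G.adj_comm e a, G.adj_comm c b, G.adj_comm d b, G.adj_comm e b, G.adj_comm d c,
        G.adj_comm e c, G.adj_comm e d]
  refine ⟨⟨![a, b, c, d, e], ?_⟩, key⟩
  intro x y hxy
  have h : ∀ z, P5.Adj x z ↔ P5.Adj y z := fun z => by rw [key, key, hxy]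
  revert h
  clear hxy
  fin_cases x <;> fin_cases y <;> simp [P5, SimpleGraph.pathGraph_adj, Fin.forall_fin_succ]

/-- An induced dart from its adjacencies and non-adjacencies. -/
lemma containsInduced_dart {V : Type*} (G : SimpleGraph V) {a b c d e : V} (hbd' : b ≠ d)
    (hab : G.Adj a b) (hbc : G.Adj b c) (hcd : G.Adj c d) (hda : G.Adj d a)
    (hac : G.Adj a c) (hce : G.Adj c e)
    (hbd : ¬ G.Adj b d) (hae : ¬ G.Adj a e) (hbe : ¬ G.Adj b e) (hde : ¬ G.Adj d e) :
    ContainsInduced G dart := by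
  have key : ∀ x y, dart.Adj x y ↔ G.Adj (![a, b, c, d, e] x) (![a, b, c, d, e] y) := by
    intro x y
    fin_cases x <;> fin_cases y <;>
      simp [dart, *, G.adj_comm b a, G.adj_comm c a, G.adj_comm a d,
        G.adj_comm e a, G.adj_comm c b, G.adj_comm d b, G.adj_comm e b, G.adj_comm d c,
        G.adj_comm e c, G.adj_comm e d]
  refine ⟨⟨![a, b, c, d, e], ?_⟩, key⟩
  intro x y hxy
  have h : ∀ z, dart.Adj x z ↔ dart.Adj y z := fun z => by rw [key, key, hxy]
  revert h hxy
  fin_cases x <;> fin_cases y <;> simp [dart, Fin.forall_fin_succ, hbd', hbd'.symm]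

section

open scoped Fin.NatCast Fin.CommRing

/-- In the complement of a cycle of length at least `7`, adjacency among six consecutive
vertices is determined by their offsets. -/
lemma antihole_adj_iff {V : Type*} (G : SimpleGraph V) {n : ℕ} [NeZero n] (hn : 7 ≤ n)
    (v : Fin n → V) (hC : ∀ i j, G.Adj (v i) (v j) ↔ (i ≠ j ∧ j ≠ i + 1 ∧ i ≠ j + 1))
    (i : Fin n) {k l : ℕ} (hk : k < 6) (hl : l < 6) :
    G.Adj (v (i + (k : Fin n))) (v (i + (l : Fin n))) ↔ k ≠ l ∧ l ≠ k + 1 ∧ k ≠ l + 1 := by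
  have cast_inj : ∀ {a b : ℕ}, a < 7 → b < 7 → ((a : Fin n) = (b : Fin n) ↔ a = b) := by
    intro a b ha hb
    rw [Fin.ext_iff, Fin.val_natCast, Fin.val_natCast, Nat.mod_eq_of_lt (by omega),
      Nat.mod_eq_of_lt (by omega)]
  have hadd : ∀ a b : ℕ, i + (a : Fin n) = i + (b : Fin n) + 1 ↔
      (a : Fin n) = ((b + 1 : ℕ) : Fin n) := by
    intro a b
    rw [add_assoc, add_right_inj, Nat.cast_succ]
  rw [hC, ne_eq, ne_eq, ne_eq, hadd, hadd, add_right_inj, cast_inj (by omega) (by omega),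
    cast_inj (by omega) (by omega), cast_inj (by omega) (by omega)]

/-- A predicate on `Fin n` closed under predecessors holds everywhere once it holds somewhere. -/
lemma Fin.forall_of_cyclic_pred {n : ℕ} [NeZero n] {P : Fin n → Prop}
    (hP : ∀ i, P (i + 1) → P i) {i : Fin n} (hi : P i) (j : Fin n) : P j := by
  have h : ∀ k : ℕ, P (i - (k : Fin n)) := by
    intro k
    induction k with
    | zero => simpa using hi
    | succ k ih =>
      apply hP
      have : i - ((k + 1 : ℕ) : Fin n) + 1 = i - (k : Fin n) := by push_cast; abel
      rwa [this]
  simpa using h (i - j).val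

/-- A set meeting every pair of cyclically consecutive elements contains at least half of them. -/
lemma Fin.le_two_mul_ncard {n : ℕ} [NeZero n] (A : Set (Fin n))
    (hA : ∀ i, i ∈ A ∨ i + 1 ∈ A) : n ≤ 2 * A.ncard := by
  have hcover : (Set.univ : Set (Fin n)) ⊆ A ∪ (fun i => i - 1) '' A := by
    intro i _
    rcases hA i with h | h
    · exact Or.inl h
    · exact Or.inr ⟨i + 1, h, by simp⟩
  have h₁ := Set.ncard_le_ncard hcover (Set.toFinite _)
  have h₂ := Set.ncard_union_le A ((fun i => i - 1) '' A)
  have h₃ := Set.ncard_image_le (f := fun i : Fin n => i - 1) (Set.toFinite A)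
  rw [Set.ncard_univ, Nat.card_eq_fintype_card, Fintype.card_fin] at h₁
  omega

/-- In a `(P5, dart)`-free graph, a vertex off an antihole cannot have the adjacency pattern
neighbor, non-neighbor, non-neighbor on three consecutive antihole vertices. -/
lemma not_adj_of_antihole {V : Type*} (G : SimpleGraph V)
    (hP5 : ¬ ContainsInduced G P5) (hdart : ¬ ContainsInduced G dart)
    {n : ℕ} [NeZero n] (hn : 7 ≤ n) (v : Fin n → V)
    (hC : ∀ i j, G.Adj (v i) (v j) ↔ (i ≠ j ∧ j ≠ i + 1 ∧ i ≠ j + 1))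
    {u : V} (hu : u ∉ Set.range v) (j : Fin n)
    (h₁ : ¬ G.Adj u (v (j + 1))) (h₂ : ¬ G.Adj u (v (j + 1 + 1))) : ¬ G.Adj u (v j) := by
  intro h₀
  set p : ℕ → V := fun k => v (j - 1 + (k : Fin n)) with hp
  have hadj : ∀ k l, k < 6 → l < 6 →
      (G.Adj (p k) (p l) ↔ k ≠ l ∧ l ≠ k + 1 ∧ k ≠ l + 1) :=
    fun k l hk hl => antihole_adj_iff G hn v hC (j - 1) hk hl
  have hpu : ∀ k, u ≠ p k := fun k h => hu ⟨_, h.symm⟩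
  have e₁ : p 1 = v j := by simp [hp]
  have e₂ : p 2 = v (j + 1) := by
    simp only [hp]; congr 1; push_cast; rw [← one_add_one_eq_two]; abel
  have e₃ : p 3 = v (j + 1 + 1) := by
    simp only [hp]; congr 1; push_cast
    rw [← two_add_one_eq_three, ← one_add_one_eq_two]; abel
  rw [← e₁] at h₀
  rw [← e₂] at h₁
  rw [← e₃] at h₂
  have hp0 : G.Adj u (p 0) := by
    by_contra hnot
    exact hP5 (containsInduced_P5 G (a := u) (b := p 1) (c := p 3) (d := p 0) (e := p 2)
      h₀ (by simp [hadj]) (by simp [hadj]) (by simp [hadj]) h₂ hnot h₁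
      (by simp [hadj]) (by simp [hadj]) (by simp [hadj]))
  have hp5 : G.Adj u (p 5) := by
    by_contra hnot
    refine hdart (containsInduced_dart G (a := p 5) (b := p 2) (c := p 0) (d := p 3) (e := u)
      ?_ (by simp [hadj]) (by simp [hadj]) (by simp [hadj]) (by simp [hadj]) (by simp [hadj])
      hp0.symm (by simp [hadj]) (mt SimpleGraph.Adj.symm hnot) (mt SimpleGraph.Adj.symm h₁) (mt SimpleGraph.Adj.symm h₂))
    intro h
    have h' := hadj 2 4 (by omega) (by omega)
    rw [h, hadj 3 4 (by omega) (by omega)] at h'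
    omega
  exact hdart (containsInduced_dart G (a := p 1) (b := u) (c := p 5) (d := p 3) (e := p 2)
    (hpu 3) h₀.symm hp5 (by simp [hadj]) (by simp [hadj]) (by simp [hadj]) (by simp [hadj])
    h₂ (by simp [hadj]) h₁ (by simp [hadj]))

end

theorem antihole_no_small_attachment {V : Type} [Fintype V] (G : SimpleGraph V)
    (hP5 : ¬ ContainsInduced G P5) (hdart : ¬ ContainsInduced G dart)
    (t : ℕ) (ht : 3 ≤ t) (v : Fin (2 * t + 1) → V) (hinj : Function.Injective v)
    (hC : ∀ i j, G.Adj (v i) (v j) ↔ (i ≠ j ∧ j ≠ i + 1 ∧ i ≠ j + 1)) :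
    ∀ u, u ∉ Set.range v → (∃ i, G.Adj u (v i)) →
      t + 1 ≤ {i : Fin (2 * t + 1) | G.Adj u (v i)}.ncard := by
  intro u hu ⟨i₀, hi₀⟩
  have hhalf := Fin.le_two_mul_ncard {i : Fin (2 * t + 1) | G.Adj u (v i)} (by
    by_contra! ⟨i, hi, hi'⟩
    exact (Fin.forall_of_cyclic_pred
      (P := fun i => ¬ G.Adj u (v i) ∧ ¬ G.Adj u (v (i + 1)))
      (fun j hj => ⟨not_adj_of_antihole G hP5 hdart (by omega) v hC hu j hj.1 hj.2, hj.1⟩)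
      ⟨hi, hi'⟩ i₀).1 hi₀)
  omega
end

section
/- Let t ≥ 3 and let G be a (P5,dart)-free finite simple graph containing an induced copy C of the complement of the (2t+1)-cycle, with vertices v1,...,v_{2t+1} such that v_i and v_j are adjacent if and only if their circular distance modulo 2t+1 is greater than 1. Let u, u' be nonadjacent vertices of G not on C, each adjacent to all 2t+1 vertices of C. Then every vertex of G not on C having at least t+1 and at most 2t neighbors on C is adjacent to at least one of u and u'. -/
open SimpleGraph

/-- Two adjacent common neighbours `a`, `c` of nonadjacent vertices `b`, `d`, together with a
vertex `e` whose only neighbour among the four is `c`, induce a dart. -/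
lemma containsInduced_dart_s19 {V : Type*} {G : SimpleGraph V} {a b c d e : V}
    (hac : G.Adj a c) (hbd : b ≠ d) (hnbd : ¬ G.Adj b d)
    (hba : G.Adj b a) (hbc : G.Adj b c) (hda : G.Adj d a) (hdc : G.Adj d c)
    (hec : G.Adj e c) (hea : ¬ G.Adj e a) (heb : ¬ G.Adj e b) (hed : ¬ G.Adj e d)
    (hneb : e ≠ b) (hned : e ≠ d) (hnea : e ≠ a) : ContainsInduced G dart := by
  have hinj : Function.Injective ![a, b, c, d, e] := by
    intro x y hxy
    have := hac.ne
    have := hba.ne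
    have := hbc.ne
    have := hda.ne
    have := hdc.ne
    have := hec.ne
    fin_cases x <;> fin_cases y <;> simp_all
  refine ⟨⟨_, hinj⟩, fun x y => ?_⟩
  fin_cases x <;> fin_cases y <;>
    simp [dart, SimpleGraph.fromRel_adj, hac, hac.symm, hnbd, hba, hba.symm, hbc,
      hbc.symm, hda, hda.symm, hdc, hdc.symm, hec, hec.symm, hea, heb, hed, mt G.adj_symm hnbd,
      mt G.adj_symm hea, mt G.adj_symm heb, mt G.adj_symm hed]

theorem antihole_nonadjacent_dominating_pair {V : Type} [Fintype V] (G : SimpleGraph V)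
    (hP5 : ¬ ContainsInduced G P5) (hdart : ¬ ContainsInduced G dart)
    (t : ℕ) (ht : 3 ≤ t) (v : Fin (2 * t + 1) → V) (hinj : Function.Injective v)
    (hC : ∀ i j, G.Adj (v i) (v j) ↔ (i ≠ j ∧ j ≠ i + 1 ∧ i ≠ j + 1))
    (u u' : V) (hu : u ∉ Set.range v) (hu' : u' ∉ Set.range v) (hne : u ≠ u')
    (hnadj : ¬ G.Adj u u')
    (huC : ∀ i, G.Adj u (v i)) (hu'C : ∀ i, G.Adj u' (v i)) :
    ∀ w, w ∉ Set.range v →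
      t + 1 ≤ {i : Fin (2 * t + 1) | G.Adj w (v i)}.ncard →
      {i : Fin (2 * t + 1) | G.Adj w (v i)}.ncard ≤ 2 * t →
      G.Adj w u ∨ G.Adj w u' := by
  intro w hw hlow hhigh
  by_contra! hcon
  obtain ⟨i, hi⟩ : ∃ i, ¬ G.Adj w (v i) := by
    by_contra! h
    have : {i : Fin (2 * t + 1) | G.Adj w (v i)} = Set.univ := Set.eq_univ_of_forall h
    rw [this, Set.ncard_univ, Nat.card_eq_fintype_card, Fintype.card_fin] at hhigh
    omega
  obtain ⟨j, hj, hji⟩ : ∃ j, G.Adj w (v j) ∧ G.Adj (v i) (v j) := by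
    by_contra! h
    have hsub : {j : Fin (2 * t + 1) | G.Adj w (v j)} ⊆ {i + 1, i - 1} := by
      intro j hj
      have hij : i ≠ j := by rintro rfl; exact hi hj
      by_contra hmem
      simp only [Set.mem_insert_iff, Set.mem_singleton_iff, not_or] at hmem
      exact h j hj ((hC i j).2 ⟨hij, hmem.1, fun e => hmem.2 (eq_sub_of_add_eq e.symm)⟩)
    have := (Set.ncard_le_ncard hsub).trans (Set.ncard_insert_le _ _)
    rw [Set.ncard_singleton] at this
    omega
  have hwu : w ≠ u := by rintro rfl; exact hi (huC i)
  have hwu' : w ≠ u' := by rintro rfl; exact hi (hu'C i)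
  have hwi : w ≠ v i := fun e => hw ⟨i, e.symm⟩
  exact hdart (containsInduced_dart_s19 hji hne hnadj (huC i) (huC j) (hu'C i) (hu'C j)
    hj hi hcon.1 hcon.2 hwu hwu' hwi)
end
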